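/- arXiv:2508.06780 — 2 statements merged into one kernel-verified Lean document; each statement's English description precedes it below -/
import Mathlib

section
/- (Varah's bound) Let A be an n × n real matrix that is strictly row diagonally dominant, i.e. for every row index i, |A_{ii}| > ∑_{j ≠ i} |A_{ij}|, and set β = min_i (|A_{ii}| − ∑_{j ≠ i} |A_{ij}|) > 0. Then A is invertible and ‖A^{-1}‖_∞ ≤ 1/β, where ‖·‖_∞ denotes the maximum-absolute-row-sum operator norm ‖M‖_∞ = max_i ∑_j |M_{ij}|. -/
/-- The maximum-absolute-row-sum (∞) operator norm of a square real matrix. -/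
noncomputable def infNorm {n : ℕ} (M : Matrix (Fin n) (Fin n) ℝ) : ℝ :=
  ⨆ i : Fin n, ∑ j : Fin n, |M i j|

/-- A matrix whose rows are all diagonally dominant with margin `β` expands the supremum norm by
a factor of at least `β`. -/
theorem mul_norm_le_norm_mulVec_of_row_dominant {ι : Type*} [Fintype ι] [DecidableEq ι]
    {A : Matrix ι ι ℝ} {β : ℝ}
    (h : ∀ i, β ≤ |A i i| - ∑ j ∈ Finset.univ.erase i, |A i j|) (x : ι → ℝ) :
    β * ‖x‖ ≤ ‖A.mulVec x‖ := by
  cases isEmpty_or_nonempty ι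
  · simp [Subsingleton.elim x 0]
  obtain ⟨k, hk⟩ := Finite.exists_max fun i => |x i|
  have hx : ‖x‖ = |x k| :=
    le_antisymm ((pi_norm_le_iff_of_nonneg (abs_nonneg _)).2 hk) (norm_le_pi_norm x k)
  have hAx : A.mulVec x k = A k k * x k + ∑ j ∈ Finset.univ.erase k, A k j * x j := by
    rw [Finset.add_sum_erase _ (fun j => A k j * x j) (Finset.mem_univ k)]
    rfl
  have hoff : |∑ j ∈ Finset.univ.erase k, A k j * x j|
      ≤ (∑ j ∈ Finset.univ.erase k, |A k j|) * |x k| := by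
    rw [Finset.sum_mul]
    refine (Finset.abs_sum_le_sum_abs _ _).trans (Finset.sum_le_sum fun j _ => ?_)
    rw [abs_mul]
    exact mul_le_mul_of_nonneg_left (hk j) (abs_nonneg _)
  have htri := abs_sub (A.mulVec x k) (∑ j ∈ Finset.univ.erase k, A k j * x j)
  rw [hAx, add_sub_cancel_right, ← hAx, abs_mul] at htri
  have hmargin := mul_le_mul_of_nonneg_right (h k) (abs_nonneg (x k))
  have hnorm : |A.mulVec x k| ≤ ‖A.mulVec x‖ := norm_le_pi_norm (A.mulVec x) k
  rw [hx]
  linarith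

/-- Varah's bound: a strictly row diagonally dominant matrix is invertible, and the
∞-norm of its inverse is at most 1/β where β is the minimal dominance. -/
theorem stmt_7 (n : ℕ) (hn : 0 < n) (A : Matrix (Fin n) (Fin n) ℝ)
    (hdom : ∀ i : Fin n, ∑ j ∈ Finset.univ.erase i, |A i j| < |A i i|)
    (β : ℝ)
    (hβ : β = ⨅ i : Fin n, (|A i i| - ∑ j ∈ Finset.univ.erase i, |A i j|)) :
    0 < β ∧ IsUnit A ∧ infNorm A⁻¹ ≤ 1 / β := by
  have : Nonempty (Fin n) := ⟨⟨0, hn⟩⟩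
  have hle : ∀ i, β ≤ |A i i| - ∑ j ∈ Finset.univ.erase i, |A i j| := fun i =>
    hβ ▸ ciInf_le (Set.finite_range _).bddBelow i
  have hpos : 0 < β := by
    obtain ⟨i, hi⟩ := exists_eq_ciInf_of_finite
      (f := fun i : Fin n => |A i i| - ∑ j ∈ Finset.univ.erase i, |A i j|)
    rw [hβ, ← hi]
    exact sub_pos.2 (hdom i)
  have hdet : IsUnit A.det :=
    isUnit_iff_ne_zero.2 (det_ne_zero_of_sum_row_lt_diag hdom)
  refine ⟨hpos, (Matrix.isUnit_iff_isUnit_det A).2 hdet, ciSup_le fun i => ?_⟩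
  let v : Fin n → ℝ := fun j => SignType.sign (A⁻¹ i j)
  have hv : ‖v‖ ≤ 1 := (pi_norm_le_iff_of_nonneg zero_le_one).2 fun j => by
    rcases lt_trichotomy (A⁻¹ i j) 0 with h | h | h <;> simp [v, h]
  have hrow : ∑ j, |A⁻¹ i j| = A⁻¹.mulVec v i :=
    Finset.sum_congr rfl fun j _ => (self_mul_sign _).symm
  have hexp := mul_norm_le_norm_mulVec_of_row_dominant hle (A⁻¹.mulVec v)
  rw [Matrix.mulVec_mulVec, Matrix.mul_nonsing_inv A hdet, Matrix.one_mulVec] at hexp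
  rw [hrow, le_div_iff₀' hpos]
  have hi : A⁻¹.mulVec v i ≤ ‖A⁻¹.mulVec v‖ :=
    (le_abs_self _).trans (norm_le_pi_norm (A⁻¹.mulVec v) i)
  exact (mul_le_mul_of_nonneg_left hi hpos.le).trans (hexp.trans hv)
end

section
/- Let A and B be n × n real matrices, suppose A is invertible and that the transpose Aᵀ is strictly row diagonally dominant with dominance β = min_k (|A_{kk}| − ∑_{l ≠ k} |A_{lk}|) > 0. Define X = (A^{-1} B)ᵀ and set R_X = ‖Bᵀ‖_∞ / β and R_Y = R_X². Then for any real numbers a, b and any h > 0, the matrix P = (a/h²) X² + (b/h) X satisfies ‖P‖_∞ ≤ (|a|/h²) R_Y + (|b|/h) R_X, where ‖·‖_∞ is the maximum-absolute-row-sum operator norm. -/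
open Matrix

section LinftyOpNorm

attribute [local instance] Matrix.linftyOpNormedAddCommGroup Matrix.linftyOpNormedSpace

theorem infNorm_eq_linfty_opNorm {n : ℕ} (M : Matrix (Fin n) (Fin n) ℝ) : infNorm M = ‖M‖ := by
  rw [Matrix.linfty_opNorm_def, Finset.sup_univ_eq_ciSup, NNReal.coe_iSup]
  simp [infNorm]

theorem infNorm_nonneg {n : ℕ} (M : Matrix (Fin n) (Fin n) ℝ) : 0 ≤ infNorm M := by
  rw [infNorm_eq_linfty_opNorm]
  exact norm_nonneg M

theorem infNorm_mul_le {n : ℕ} (M N : Matrix (Fin n) (Fin n) ℝ) :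
    infNorm (M * N) ≤ infNorm M * infNorm N := by
  simp only [infNorm_eq_linfty_opNorm]
  exact Matrix.linfty_opNorm_mul M N

theorem infNorm_add_le {n : ℕ} (M N : Matrix (Fin n) (Fin n) ℝ) :
    infNorm (M + N) ≤ infNorm M + infNorm N := by
  simp only [infNorm_eq_linfty_opNorm]
  exact norm_add_le M N

theorem infNorm_smul {n : ℕ} (c : ℝ) (M : Matrix (Fin n) (Fin n) ℝ) :
    infNorm (c • M) = |c| * infNorm M := by
  simp only [infNorm_eq_linfty_opNorm]
  exact norm_smul c M

theorem infNorm_le_of_forall_norm_mulVec_le {n : ℕ} {M : Matrix (Fin n) (Fin n) ℝ} {c : ℝ}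
    (hc : 0 ≤ c) (hM : ∀ v, ‖M *ᵥ v‖ ≤ c * ‖v‖) : infNorm M ≤ c := by
  rw [infNorm_eq_linfty_opNorm, Matrix.linfty_opNorm_eq_opNorm]
  exact ContinuousLinearMap.opNorm_le_bound _ hc hM

end LinftyOpNorm

/-- A row diagonally dominant matrix with dominance at least `β` expands the sup norm by at
least the factor `β`. -/
theorem mul_norm_le_norm_mulVec_of_dominant {n : ℕ} {C : Matrix (Fin n) (Fin n) ℝ} {β : ℝ}
    (hC : ∀ k, β ≤ |C k k| - ∑ l ∈ Finset.univ.erase k, |C k l|) (v : Fin n → ℝ) :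
    β * ‖v‖ ≤ ‖C *ᵥ v‖ := by
  rcases isEmpty_or_nonempty (Fin n) with _ | _
  · simp [Subsingleton.elim v 0]
  obtain ⟨k, hk⟩ := Finite.exists_max fun i => ‖v i‖
  have hv : ‖v‖ = |v k| :=
    le_antisymm ((pi_norm_le_iff_of_nonneg (abs_nonneg _)).2 hk) (norm_le_pi_norm v k)
  have hsplit : (C *ᵥ v) k = C k k * v k + ∑ l ∈ Finset.univ.erase k, C k l * v l :=
    (Finset.add_sum_erase _ (fun l => C k l * v l) (Finset.mem_univ k)).symm
  have hoff : |∑ l ∈ Finset.univ.erase k, C k l * v l| ≤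
      (∑ l ∈ Finset.univ.erase k, |C k l|) * |v k| := by
    rw [Finset.sum_mul]
    refine (Finset.abs_sum_le_sum_abs _ _).trans (Finset.sum_le_sum fun l _ => ?_)
    rw [abs_mul]
    exact mul_le_mul_of_nonneg_left (hk l) (abs_nonneg _)
  calc β * ‖v‖ ≤ (|C k k| - ∑ l ∈ Finset.univ.erase k, |C k l|) * |v k| := by
        rw [hv]
        exact mul_le_mul_of_nonneg_right (hC k) (abs_nonneg _)
    _ ≤ |C k k * v k| - |∑ l ∈ Finset.univ.erase k, C k l * v l| := by
        rw [abs_mul]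
        linarith
    _ ≤ |(C *ᵥ v) k| := by
        rw [hsplit]
        exact abs_sub_abs_le_abs_add _ _
    _ ≤ ‖C *ᵥ v‖ := norm_le_pi_norm (C *ᵥ v) k

/-- The Ahlberg–Nilson–Varah bound for the inverse of a row diagonally dominant matrix. -/
theorem infNorm_inv_le_of_dominant {n : ℕ} {C : Matrix (Fin n) (Fin n) ℝ} {β : ℝ}
    (hβ : 0 < β) (hunit : IsUnit C)
    (hC : ∀ k, β ≤ |C k k| - ∑ l ∈ Finset.univ.erase k, |C k l|) :
    infNorm C⁻¹ ≤ β⁻¹ := by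
  refine infNorm_le_of_forall_norm_mulVec_le (inv_nonneg.2 hβ.le) fun v => ?_
  have hv := mul_norm_le_norm_mulVec_of_dominant hC (C⁻¹ *ᵥ v)
  rw [Matrix.mulVec_mulVec, Matrix.mul_nonsing_inv _ ((Matrix.isUnit_iff_isUnit_det C).1 hunit),
    Matrix.one_mulVec] at hv
  exact (le_inv_mul_iff₀ hβ).2 hv

/-- Bound on the ∞-norm of the discrete spatial operator P = (a/h²)Y + (b/h)X of the
differential quadrature method, where X = (A⁻¹B)ᵀ and Y = X². -/
theorem stmt_8 (n : ℕ) (hn : 0 < n) (A B : Matrix (Fin n) (Fin n) ℝ)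
    (hA : IsUnit A)
    (hdom : ∀ k : Fin n, ∑ l ∈ Finset.univ.erase k, |Aᵀ k l| < |Aᵀ k k|)
    (β : ℝ)
    (hβ : β = ⨅ k : Fin n, (|A k k| - ∑ l ∈ Finset.univ.erase k, |A l k|))
    (X : Matrix (Fin n) (Fin n) ℝ) (hX : X = (A⁻¹ * B)ᵀ)
    (RX RY : ℝ) (hRX : RX = infNorm Bᵀ / β) (hRY : RY = RX ^ 2)
    (a b h : ℝ) (hh : 0 < h)
    (P : Matrix (Fin n) (Fin n) ℝ) (hP : P = (a / h ^ 2) • (X * X) + (b / h) • X) :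
    infNorm P ≤ (|a| / h ^ 2) * RY + (|b| / h) * RX := by
  have : Nonempty (Fin n) := ⟨⟨0, hn⟩⟩
  have hβ_le : ∀ k, β ≤ |Aᵀ k k| - ∑ l ∈ Finset.univ.erase k, |Aᵀ k l| := fun k =>
    hβ ▸ ciInf_le (Set.finite_range _).bddBelow k
  have hβ_pos : 0 < β := by
    obtain ⟨k, hk⟩ := exists_eq_ciInf_of_finite
      (f := fun k : Fin n => |A k k| - ∑ l ∈ Finset.univ.erase k, |A l k|)
    rw [hβ, ← hk]
    exact sub_pos.2 (hdom k)
  have hX_le : infNorm X ≤ RX := by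
    rw [hX, hRX, Matrix.transpose_mul, Matrix.transpose_nonsing_inv, div_eq_mul_inv]
    exact (infNorm_mul_le _ _).trans (mul_le_mul_of_nonneg_left
      (infNorm_inv_le_of_dominant hβ_pos ((Matrix.isUnit_transpose A).2 hA) hβ_le)
      (infNorm_nonneg _))
  have hY_le : infNorm (X * X) ≤ RY := by
    rw [hRY, sq]
    exact (infNorm_mul_le X X).trans
      (mul_self_le_mul_self (infNorm_nonneg X) hX_le)
  calc infNorm P ≤ |a / h ^ 2| * infNorm (X * X) + |b / h| * infNorm X := by
        rw [hP, ← infNorm_smul, ← infNorm_smul]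
        exact infNorm_add_le _ _
    _ = |a| / h ^ 2 * infNorm (X * X) + |b| / h * infNorm X := by
        rw [abs_div, abs_div, abs_of_pos hh, abs_of_pos (pow_pos hh 2)]
    _ ≤ |a| / h ^ 2 * RY + |b| / h * RX := by gcongr
end
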